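/- (Likelihood-ratio form of the policy gradient.) For the finite-horizon MDP and parameterized policy described in the context, the value V(θ) = Σ_τ P_θ(τ) · R(τ) is differentiable in θ, and its gradient satisfies ∇_θ V(θ) = Σ_τ P_θ(τ) · (Σ_{t=0}^{H−1} ∇_θ log π_θ(a_t | s_t)) · R(τ), where the sums range over all trajectories τ. -/

import Mathlib

open Finset

noncomputable section

/-- A trajectory of horizon `H`: an initial state together with `H` (action, next-state)
pairs, i.e. an element of `S × (A × S)^H`. -/
abbrev Traj (S A : Type*) (H : ℕ) := S × (Fin H → A × S)

/-- The state `s_t` visited at time `t ≤ H` along a trajectory. -/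
def trajState {S A : Type*} {H : ℕ} (τ : Traj S A H) (t : Fin (H + 1)) : S :=
  if h : (t : ℕ) = 0 then τ.1
  else (τ.2 ⟨(t : ℕ) - 1, by have := t.isLt; omega⟩).2

/-- The action `a_t` taken at time `t < H` along a trajectory. -/
def trajAction {S A : Type*} {H : ℕ} (τ : Traj S A H) (t : Fin H) : A := (τ.2 t).1

/-- The probability `P_θ(τ) = p₀(s₀) ∏_t π_θ(a_t|s_t) P(s_t, a_t, s_{t+1})`. -/
def trajProb {S A : Type*} {d H : ℕ} (p0 : S → ℝ) (P : S → A → S → ℝ)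
    (pol : (Fin d → ℝ) → S → A → ℝ) (θ : Fin d → ℝ) (τ : Traj S A H) : ℝ :=
  p0 (trajState τ 0) *
    ∏ t : Fin H, pol θ (trajState τ t.castSucc) (trajAction τ t) *
      P (trajState τ t.castSucc) (trajAction τ t) (trajState τ t.succ)

/-- The discounted return `R(τ) = Σ_t γ^t r(s_t, a_t)`. -/
def trajReturn {S A : Type*} {H : ℕ} (r : S → A → ℝ) (γ : ℝ) (τ : Traj S A H) : ℝ :=
  ∑ t : Fin H, γ ^ (t : ℕ) * r (trajState τ t.castSucc) (trajAction τ t)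

/-- The value `V(θ) = Σ_τ P_θ(τ) R(τ)`. -/
def value {S A : Type*} [Fintype S] [Fintype A] [DecidableEq A] [DecidableEq S]
    {d : ℕ} (H : ℕ) (p0 : S → ℝ) (P : S → A → S → ℝ)
    (pol : (Fin d → ℝ) → S → A → ℝ) (r : S → A → ℝ) (γ : ℝ) (θ : Fin d → ℝ) : ℝ :=
  ∑ τ : Traj S A H, trajProb p0 P pol θ τ * trajReturn r γ τ

/-- The score-function identity for finite products of positive functions:
`∇ ∏ f_i = (∏ f_i) ∑ ∇ log f_i`. -/
theorem hasFDerivAt_prod_of_pos {ι E : Type*} [NormedAddCommGroup E] [NormedSpace ℝ E]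
    (u : Finset ι) (f : ι → E → ℝ) (x : E) (hpos : ∀ i ∈ u, ∀ y, 0 < f i y)
    (hdiff : ∀ i ∈ u, DifferentiableAt ℝ (f i) x) :
    HasFDerivAt (fun y => ∏ i ∈ u, f i y)
      ((∏ i ∈ u, f i x) • ∑ i ∈ u, fderiv ℝ (fun y => Real.log (f i y)) x) x := by
  have hexp : ∀ y, Real.exp (∑ i ∈ u, Real.log (f i y)) = ∏ i ∈ u, f i y := fun y => by
    rw [Real.exp_sum]
    exact Finset.prod_congr rfl fun i hi => Real.exp_log (hpos i hi y)
  have hlog : HasFDerivAt (fun y => ∑ i ∈ u, Real.log (f i y))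
      (∑ i ∈ u, fderiv ℝ (fun y => Real.log (f i y)) x) x :=
    HasFDerivAt.fun_sum fun i hi => ((hdiff i hi).log (hpos i hi x).ne').hasFDerivAt
  simpa only [hexp] using hlog.exp

/-- The gradient of the probability of a trajectory is the probability times the score. -/
theorem hasFDerivAt_trajProb {S A : Type*} {d H : ℕ} (p0 : S → ℝ) (P : S → A → S → ℝ)
    (pol : (Fin d → ℝ) → S → A → ℝ) (hpos : ∀ θ s a, 0 < pol θ s a)
    (hdiff : ∀ s a, Differentiable ℝ (fun θ => pol θ s a)) (θ : Fin d → ℝ)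
    (τ : Traj S A H) :
    HasFDerivAt (fun θ' => trajProb p0 P pol θ' τ)
      (trajProb p0 P pol θ τ • ∑ t : Fin H,
        fderiv ℝ (fun θ' => Real.log (pol θ' (trajState τ t.castSucc) (trajAction τ t))) θ)
      θ := by
  have hprod := hasFDerivAt_prod_of_pos Finset.univ
    (fun (t : Fin H) θ' => pol θ' (trajState τ t.castSucc) (trajAction τ t)) θ
    (fun _ _ _ => hpos _ _ _) (fun _ _ => hdiff _ _ θ)
  simp only [trajProb, Finset.prod_mul_distrib]
  refine ((hprod.mul_const _).const_mul _).congr_fderiv ?_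
  simp only [smul_smul]
  congr 1
  ring

/-- likelihood-ratio form of the policy gradient: `V` is
differentiable and `∇V(θ) = Σ_τ P_θ(τ) (Σ_t ∇ log π_θ(a_t|s_t)) R(τ)`. -/
theorem policy_gradient_likelihood_ratio
    {S A : Type*} [Fintype S] [Fintype A] [DecidableEq A] [DecidableEq S]
    [Nonempty S] [Nonempty A] {d : ℕ}
    (p0 : S → ℝ) (hp0 : ∀ s, 0 ≤ p0 s) (hp0sum : ∑ s, p0 s = 1)
    (P : S → A → S → ℝ) (hP : ∀ s a s', 0 ≤ P s a s')
    (hPsum : ∀ s a, ∑ s', P s a s' = 1)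
    (r : S → A → ℝ) (H : ℕ) (γ : ℝ) (hγ : γ ∈ Set.Icc (0 : ℝ) 1)
    (pol : (Fin d → ℝ) → S → A → ℝ)
    (hpos : ∀ θ s a, 0 < pol θ s a) (hsum : ∀ θ s, ∑ a, pol θ s a = 1)
    (hdiff : ∀ s a, Differentiable ℝ (fun θ => pol θ s a)) :
    Differentiable ℝ (value H p0 P pol r γ) ∧
      ∀ θ : Fin d → ℝ,
        fderiv ℝ (value H p0 P pol r γ) θ =
          ∑ τ : Traj S A H,
            (trajProb p0 P pol θ τ * trajReturn r γ τ) •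
              ∑ t : Fin H,
                fderiv ℝ
                  (fun θ' => Real.log (pol θ' (trajState τ t.castSucc) (trajAction τ t)))
                  θ := by
  have hvalue : ∀ θ, HasFDerivAt (value H p0 P pol r γ)
      (∑ τ : Traj S A H,
        (trajProb p0 P pol θ τ * trajReturn r γ τ) •
          ∑ t : Fin H,
            fderiv ℝ
              (fun θ' => Real.log (pol θ' (trajState τ t.castSucc) (trajAction τ t)))
              θ) θ := fun θ => by
    refine HasFDerivAt.fun_sum fun τ _ =>
      ((hasFDerivAt_trajProb p0 P pol hpos hdiff θ τ).mul_const (trajReturn r γ τ)).congr_fderiv ?_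
    rw [smul_smul, mul_comm]
  exact ⟨fun θ => (hvalue θ).differentiableAt, fun θ => (hvalue θ).fderiv⟩

end
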